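/- Let W₁, W₂, W₃, Y₁, Y₂, Y_{3D}, Y_{3P}, S be random variables on a common probability space taking values in finite measurable types, let Y₃ denote the pair (Y_{3D}, Y_{3P}), and let ε ≥ 0. Assume: (i) H(W_i | (Y_i, S)) ≤ ε for i = 1, 2, 3; (ii) I(W₂ ; Y₁ | S) ≤ ε; (iii) I(W₃ ; (Y₁, Y₂) | S) ≤ ε; (iv) I(W₃ ; W₁ | S) = 0; (v) H(Y_{3D} | (Y₁, Y₂, W₁, S)) ≤ H(Y₁ | (W₁, S)). Then H(W₁ | S) + H(W₂ | S) + H(W₃ | S) ≤ H(Y₁ | S) + H(Y₂ | S) + H(Y_{3P} | S) + 6ε. -/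

import Mathlib

open MeasureTheory

namespace Paper

variable {Ω : Type*} [MeasurableSpace Ω]

/-- Shannon entropy of a finitely-valued random variable. -/
noncomputable def entH {S : Type*} [Fintype S] [MeasurableSpace S]
    (μ : Measure Ω) (X : Ω → S) : ℝ :=
  ∑ s : S, Real.negMulLog ((μ.map X) {s}).toReal

/-- Conditional Shannon entropy `H(X | Y)`. -/
noncomputable def condH {S T : Type*} [Fintype S] [MeasurableSpace S]
    [Fintype T] [MeasurableSpace T] (μ : Measure Ω) (X : Ω → S) (Y : Ω → T) : ℝ :=
  entH μ (fun ω => (X ω, Y ω)) - entH μ Y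

/-- Mutual information `I(X ; Y)`. -/
noncomputable def mutI {S T : Type*} [Fintype S] [MeasurableSpace S]
    [Fintype T] [MeasurableSpace T] (μ : Measure Ω) (X : Ω → S) (Y : Ω → T) : ℝ :=
  entH μ X + entH μ Y - entH μ (fun ω => (X ω, Y ω))

/-- Conditional mutual information `I(X ; Y | Z)`. -/
noncomputable def condI {S T U : Type*} [Fintype S] [MeasurableSpace S]
    [Fintype T] [MeasurableSpace T] [Fintype U] [MeasurableSpace U]
    (μ : Measure Ω) (X : Ω → S) (Y : Ω → T) (Z : Ω → U) : ℝ :=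
  condH μ X Z + condH μ Y Z - condH μ (fun ω => (X ω, Y ω)) Z

/-- Marginalisation: the mass function of `Z = f ∘ X` is obtained by summing that of `X` over the
fibres of `f`. -/
theorem map_apply_eq_sum {S T : Type*} [Fintype S] [DecidableEq T]
    [MeasurableSpace S] [MeasurableSingletonClass S]
    [MeasurableSpace T] [MeasurableSingletonClass T] (μ : Measure Ω) [IsFiniteMeasure μ]
    {X : Ω → S} {Z : Ω → T} (hX : Measurable X) (hZ : Measurable Z) (f : S → T)
    (h : ∀ ω, Z ω = f (X ω)) (t : T) :
    ((μ.map Z) {t}).toReal = ∑ s with f s = t, ((μ.map X) {s}).toReal := by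
  have hset : Z ⁻¹' {t} = X ⁻¹' ↑(Finset.univ.filter fun s => f s = t) := by
    ext ω
    simp [h ω]
  rw [Measure.map_apply hZ (measurableSet_singleton t), hset,
    ← Measure.map_apply hX (Finset.measurableSet _), ← sum_measure_singleton,
    ENNReal.toReal_sum fun _ _ => measure_ne_top _ _]

/-- A function of a random variable has at most the entropy of that random variable. -/
theorem entH_le_of_comp {S T : Type*} [Fintype S] [Fintype T]
    [MeasurableSpace S] [MeasurableSingletonClass S]
    [MeasurableSpace T] [MeasurableSingletonClass T] (μ : Measure Ω) [IsFiniteMeasure μ]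
    {X : Ω → S} {Z : Ω → T} (hX : Measurable X) (hZ : Measurable Z) (f : S → T)
    (h : ∀ ω, Z ω = f (X ω)) : entH μ Z ≤ entH μ X := by
  classical
  unfold entH
  rw [← Finset.sum_fiberwise Finset.univ f]
  refine Finset.sum_le_sum fun t _ => ?_
  rw [map_apply_eq_sum μ hX hZ f h t, Real.negMulLog, ← Finset.sum_neg_distrib, Finset.sum_mul]
  refine Finset.sum_le_sum fun s hs => ?_
  rw [Real.negMulLog]
  have h0 : 0 ≤ ((μ.map X) {s}).toReal := ENNReal.toReal_nonneg
  rcases h0.eq_or_lt with h0 | h0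
  · simp [← h0]
  · have hle := Finset.single_le_sum (f := fun s => ((μ.map X) {s}).toReal)
      (fun _ _ => ENNReal.toReal_nonneg) hs
    have hlog := Real.log_le_log h0 hle
    exact mul_le_mul_of_nonpos_left hlog (by linarith)

theorem mul_log_le_div_sub {p q s r : ℝ} (hp : 0 ≤ p) (hpq : p ≤ q) (hps : p ≤ s) (hsr : s ≤ r) :
    p * (Real.log q + Real.log s - Real.log r - Real.log p) ≤ q * s / r - p := by
  rcases hp.eq_or_lt with rfl | hp
  · have : 0 ≤ q * s / r := div_nonneg (mul_nonneg hpq hps) (hps.trans hsr)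
    simpa using this
  · have hq : 0 < q := hp.trans_le hpq
    have hs : 0 < s := hp.trans_le hps
    have hr : 0 < r := hs.trans_le hsr
    have hlog : Real.log (q * s / (r * p))
        = Real.log q + Real.log s - Real.log r - Real.log p := by
      rw [Real.log_div (by positivity) (by positivity), Real.log_mul hq.ne' hs.ne',
        Real.log_mul hr.ne' hp.ne']
      ring
    have hle := Real.log_le_sub_one_of_pos (show 0 < q * s / (r * p) by positivity)
    rw [← hlog]
    calc p * Real.log (q * s / (r * p)) ≤ p * (q * s / (r * p) - 1) := by gcongr
      _ = q * s / r - p := by field_simp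

/-- Submodularity of entropy for a nonnegative mass function on a triple product. -/
theorem sum_negMulLog_submodular {A B C : Type*} [Fintype A] [Fintype B] [Fintype C]
    (p : A → B → C → ℝ) (hp : ∀ a b c, 0 ≤ p a b c) :
    (∑ a, ∑ b, ∑ c, Real.negMulLog (p a b c)) + ∑ c, Real.negMulLog (∑ a, ∑ b, p a b c) ≤
      (∑ a, ∑ c, Real.negMulLog (∑ b, p a b c)) + ∑ b, ∑ c, Real.negMulLog (∑ a, p a b c) := by
  set q : A → C → ℝ := fun a c => ∑ b, p a b c with hq
  set s : B → C → ℝ := fun b c => ∑ a, p a b c with hs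
  set r : C → ℝ := fun c => ∑ a, ∑ b, p a b c with hr
  have hrs : ∀ c, r c = ∑ b, s b c := fun c => Finset.sum_comm
  have hpoint : ∀ a b c, p a b c *
      (Real.log (q a c) + Real.log (s b c) - Real.log (r c) - Real.log (p a b c)) ≤
      q a c * s b c / r c - p a b c := fun a b c => by
    refine mul_log_le_div_sub (hp a b c) ?_ ?_ ?_
    · exact Finset.single_le_sum (f := fun b => p a b c) (fun b _ => hp a b c) (Finset.mem_univ b)
    · exact Finset.single_le_sum (f := fun a => p a b c) (fun a _ => hp a b c) (Finset.mem_univ a)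
    · rw [hrs]
      exact Finset.single_le_sum (f := fun b => s b c)
        (fun b _ => Finset.sum_nonneg fun a _ => hp a b c) (Finset.mem_univ b)
  have hsum : ∑ c, ∑ a, ∑ b, p a b c *
      (Real.log (q a c) + Real.log (s b c) - Real.log (r c) - Real.log (p a b c)) ≤ 0 := by
    calc _ ≤ ∑ c, ∑ a, ∑ b, (q a c * s b c / r c - p a b c) :=
          Finset.sum_le_sum fun c _ => Finset.sum_le_sum fun a _ =>
            Finset.sum_le_sum fun b _ => hpoint a b c
      _ = ∑ c, (r c * r c / r c - r c) := by
          refine Finset.sum_congr rfl fun c _ => ?_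
          simp only [Finset.sum_sub_distrib]
          congr 1
          have hmul : r c * r c = (∑ a, q a c) * ∑ b, s b c := by rw [← hrs]
          rw [hmul, Finset.sum_mul_sum, Finset.sum_div]
          simp only [Finset.sum_div]
      _ = 0 := Finset.sum_eq_zero fun c _ => by rw [mul_self_div_self, sub_self]
  have e₁ : ∑ a, ∑ b, ∑ c, Real.negMulLog (p a b c)
      = ∑ c, ∑ a, ∑ b, -(p a b c * Real.log (p a b c)) := by
    simp only [Real.negMulLog, neg_mul]
    rw [Finset.sum_comm]
    simp only [Finset.sum_comm (s := (Finset.univ : Finset A)) (t := (Finset.univ : Finset C))]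
    rw [Finset.sum_comm]
    exact Finset.sum_congr rfl fun c _ => Finset.sum_comm
  have e₂ : ∑ c, Real.negMulLog (r c) = ∑ c, ∑ a, ∑ b, -(p a b c * Real.log (r c)) := by
    simp only [Real.negMulLog, Finset.sum_neg_distrib, ← Finset.sum_mul, neg_mul, hr]
  have e₃ : ∑ a, ∑ c, Real.negMulLog (q a c)
      = ∑ c, ∑ a, ∑ b, -(p a b c * Real.log (q a c)) := by
    rw [Finset.sum_comm]
    simp only [Real.negMulLog, Finset.sum_neg_distrib, ← Finset.sum_mul, neg_mul, hq]
  have e₄ : ∑ b, ∑ c, Real.negMulLog (s b c)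
      = ∑ c, ∑ a, ∑ b, -(p a b c * Real.log (s b c)) := by
    rw [Finset.sum_comm]
    refine Finset.sum_congr rfl fun c _ => ?_
    rw [Finset.sum_comm]
    simp only [Real.negMulLog, Finset.sum_neg_distrib, ← Finset.sum_mul, neg_mul, hs]
  rw [e₁, e₂, e₃, e₄]
  simp only [mul_add, mul_sub, Finset.sum_add_distrib, Finset.sum_sub_distrib] at hsum
  simp only [Finset.sum_neg_distrib]
  linarith

/-- Strong subadditivity: `H(X, Y, Z) + H(Z) ≤ H(X, Z) + H(Y, Z)`. -/
theorem entH_submodular {A B C : Type*} [Fintype A] [Fintype B] [Fintype C]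
    [MeasurableSpace A] [MeasurableSingletonClass A]
    [MeasurableSpace B] [MeasurableSingletonClass B]
    [MeasurableSpace C] [MeasurableSingletonClass C] (μ : Measure Ω) [IsFiniteMeasure μ]
    {X : Ω → A} {Y : Ω → B} {Z : Ω → C}
    (hX : Measurable X) (hY : Measurable Y) (hZ : Measurable Z) :
    entH μ (fun ω => (X ω, Y ω, Z ω)) + entH μ Z ≤
      entH μ (fun ω => (X ω, Z ω)) + entH μ (fun ω => (Y ω, Z ω)) := by
  classical
  set p : A → B → C → ℝ := fun a b c =>
    ((μ.map fun ω => (X ω, Y ω, Z ω)) {(a, b, c)}).toReal with hp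
  have hXYZ : Measurable fun ω => (X ω, Y ω, Z ω) := by fun_prop
  have hXZ : ∀ a c, ((μ.map fun ω => (X ω, Z ω)) {(a, c)}).toReal = ∑ b, p a b c := by
    intro a c
    rw [map_apply_eq_sum μ hXYZ (by fun_prop) (fun x => (x.1, x.2.2)) (fun _ => rfl),
      Finset.sum_filter]
    simp [Fintype.sum_prod_type, Prod.ext_iff, hp, ite_and]
  have hYZ : ∀ b c, ((μ.map fun ω => (Y ω, Z ω)) {(b, c)}).toReal = ∑ a, p a b c := by
    intro b c
    rw [map_apply_eq_sum μ hXYZ (by fun_prop) (fun x => x.2) (fun _ => rfl),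
      Finset.sum_filter]
    simp [Fintype.sum_prod_type, Prod.ext_iff, hp, ite_and]
  have hZ' : ∀ c, ((μ.map Z) {c}).toReal = ∑ a, ∑ b, p a b c := by
    intro c
    rw [map_apply_eq_sum μ hXYZ hZ (fun x => x.2.2) (fun _ => rfl), Finset.sum_filter]
    simp [Fintype.sum_prod_type, hp]
  simpa only [entH, Fintype.sum_prod_type, hXZ, hYZ, hZ'] using
    sum_negMulLog_submodular p fun _ _ _ => ENNReal.toReal_nonneg

/-- Entropic core of the 3-user converse (Corollary 1): with `Y₃ = (Y₃D, Y₃P)`, Fano,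
secrecy, message independence and the SEP consequence (eq:b1) give
`H(W₁|S)+H(W₂|S)+H(W₃|S) ≤ H(Y₁|S)+H(Y₂|S)+H(Y₃P|S)+6ε`. -/
theorem stmt_10 {Ω : Type*} [MeasurableSpace Ω] (μ : Measure Ω) [IsProbabilityMeasure μ]
    {α₁ α₂ α₃ β₁ β₂ βD βP σ : Type*}
    [Fintype α₁] [Nonempty α₁] [MeasurableSpace α₁] [MeasurableSingletonClass α₁]
    [Fintype α₂] [Nonempty α₂] [MeasurableSpace α₂] [MeasurableSingletonClass α₂]
    [Fintype α₃] [Nonempty α₃] [MeasurableSpace α₃] [MeasurableSingletonClass α₃]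
    [Fintype β₁] [Nonempty β₁] [MeasurableSpace β₁] [MeasurableSingletonClass β₁]
    [Fintype β₂] [Nonempty β₂] [MeasurableSpace β₂] [MeasurableSingletonClass β₂]
    [Fintype βD] [Nonempty βD] [MeasurableSpace βD] [MeasurableSingletonClass βD]
    [Fintype βP] [Nonempty βP] [MeasurableSpace βP] [MeasurableSingletonClass βP]
    [Fintype σ] [Nonempty σ] [MeasurableSpace σ] [MeasurableSingletonClass σ]
    (W₁ : Ω → α₁) (W₂ : Ω → α₂) (W₃ : Ω → α₃)
    (Y₁ : Ω → β₁) (Y₂ : Ω → β₂) (Y₃D : Ω → βD) (Y₃P : Ω → βP) (S : Ω → σ)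
    (hW₁ : Measurable W₁) (hW₂ : Measurable W₂) (hW₃ : Measurable W₃)
    (hY₁ : Measurable Y₁) (hY₂ : Measurable Y₂)
    (hY₃D : Measurable Y₃D) (hY₃P : Measurable Y₃P) (hS : Measurable S)
    {ε : ℝ} (hε : 0 ≤ ε)
    (hfano₁ : condH μ W₁ (fun ω => (Y₁ ω, S ω)) ≤ ε)
    (hfano₂ : condH μ W₂ (fun ω => (Y₂ ω, S ω)) ≤ ε)
    (hfano₃ : condH μ W₃ (fun ω => ((Y₃D ω, Y₃P ω), S ω)) ≤ ε)
    (hsec₂ : condI μ W₂ Y₁ S ≤ ε)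
    (hsec₃ : condI μ W₃ (fun ω => (Y₁ ω, Y₂ ω)) S ≤ ε)
    (hindep : condI μ W₃ W₁ S = 0)
    (hsep : condH μ Y₃D (fun ω => (Y₁ ω, Y₂ ω, W₁ ω, S ω)) ≤
      condH μ Y₁ (fun ω => (W₁ ω, S ω))) :
    condH μ W₁ S + condH μ W₂ S + condH μ W₃ S ≤
      condH μ Y₁ S + condH μ Y₂ S + condH μ Y₃P S + 6 * ε := by
  have h₂ : entH μ (fun ω => (W₂ ω, S ω)) ≤ entH μ (fun ω => (W₂ ω, Y₂ ω, S ω)) :=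
    entH_le_of_comp μ (by fun_prop) (by fun_prop) (fun x => (x.1, x.2.2)) fun _ => rfl
  have h₃ := entH_submodular μ hW₃ (hY₁.prodMk (hY₂.prodMk hW₁)) ((hY₃D.prodMk hY₃P).prodMk hS)
  have hdrop : entH μ (fun ω => (W₃ ω, (Y₁ ω, Y₂ ω, W₁ ω), S ω)) ≤
      entH μ (fun ω => (W₃ ω, (Y₁ ω, Y₂ ω, W₁ ω), (Y₃D ω, Y₃P ω), S ω)) :=
    entH_le_of_comp μ (by fun_prop) (by fun_prop) (fun x => (x.1, x.2.1, x.2.2.2)) fun _ => rfl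
  have hP := entH_submodular μ hY₃P (hY₃D.prodMk (hY₁.prodMk (hY₂.prodMk hW₁))) hS
  have hPeq : entH μ (fun ω => ((Y₁ ω, Y₂ ω, W₁ ω), (Y₃D ω, Y₃P ω), S ω)) ≤
      entH μ (fun ω => (Y₃P ω, (Y₃D ω, Y₁ ω, Y₂ ω, W₁ ω), S ω)) :=
    entH_le_of_comp μ (by fun_prop) (by fun_prop)
      (fun x => (x.2.1.2, (x.2.1.1, x.1), x.2.2)) fun _ => rfl
  have hDeq : entH μ (fun ω => ((Y₃D ω, Y₁ ω, Y₂ ω, W₁ ω), S ω)) ≤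
      entH μ (fun ω => (Y₃D ω, Y₁ ω, Y₂ ω, W₁ ω, S ω)) :=
    entH_le_of_comp μ (by fun_prop) (by fun_prop)
      (fun x => ((x.1, x.2.1, x.2.2.1, x.2.2.2.1), x.2.2.2.2)) fun _ => rfl
  have h₁ := entH_submodular μ hW₁ hY₂ (hY₁.prodMk hS)
  have hVeq : entH μ (fun ω => (Y₁ ω, Y₂ ω, W₁ ω, S ω)) ≤
      entH μ (fun ω => (W₁ ω, Y₂ ω, Y₁ ω, S ω)) :=
    entH_le_of_comp μ (by fun_prop) (by fun_prop)
      (fun x => (x.2.2.1, x.2.1, x.1, x.2.2.2)) fun _ => rfl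
  have hYeq : entH μ (fun ω => (Y₂ ω, Y₁ ω, S ω)) ≤ entH μ (fun ω => ((Y₁ ω, Y₂ ω), S ω)) :=
    entH_le_of_comp μ (by fun_prop) (by fun_prop) (fun x => (x.1.2, x.1.1, x.2)) fun _ => rfl
  have hWeq : entH μ (fun ω => (Y₁ ω, W₁ ω, S ω)) ≤ entH μ (fun ω => (W₁ ω, Y₁ ω, S ω)) :=
    entH_le_of_comp μ (by fun_prop) (by fun_prop) (fun x => (x.2.1, x.1, x.2.2)) fun _ => rfl
  have hW₁drop : entH μ (fun ω => ((W₃ ω, Y₁ ω, Y₂ ω), S ω)) ≤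
      entH μ (fun ω => (W₃ ω, (Y₁ ω, Y₂ ω, W₁ ω), S ω)) :=
    entH_le_of_comp μ (by fun_prop) (by fun_prop)
      (fun x => ((x.1, x.2.1.1, x.2.1.2.1), x.2.2)) fun _ => rfl
  simp only [condI, condH] at *
  linarith

end Paper
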